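/- For every integer n ≥ 5, the uniform domination number of the alternating group A_n is at most 77·log₂(n): there exists s ∈ A_n and a subset S of the conjugacy class of s with |S| ≤ 77·log₂(n) such that for every nontrivial x ∈ A_n there exists y ∈ S with ⟨x,y⟩ = A_n. -/

import Mathlib

namespace AUD

open Finset in
theorem greedy_aux {X Y : Type*} [Fintype X] [Fintype Y] [Nonempty Y] [DecidableEq Y]
    (R : X → Y → Prop) [∀ x y, Decidable (R x y)]
    (h : ∀ x, 2 * Fintype.card Y ≤ 27 * #{y | R x y}) (k : ℕ) :
    ∃ T : Finset Y, #T ≤ k ∧ 27 ^ k * #{x | ∀ y ∈ T, ¬ R x y} ≤ 25 ^ k * Fintype.card X := by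
  induction k with
  | zero => exact ⟨∅, by simp⟩
  | succ k ih =>
    obtain ⟨T, hT, hc⟩ := ih
    set N : Finset X := {x | ∀ y ∈ T, ¬ R x y} with hN
    have key : ∃ y, 2 * #N ≤ 27 * #{x ∈ N | R x y} := by
      by_contra! hcon
      have h1 : ∑ y : Y, 27 * #{x ∈ N | R x y} < ∑ y : Y, 2 * #N :=
        Finset.sum_lt_sum_of_nonempty univ_nonempty (fun y _ => hcon y)
      have h2 : ∑ y : Y, #{x ∈ N | R x y} = ∑ x ∈ N, #{y | R x y} := by
        simp only [Finset.card_filter]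
        rw [Finset.sum_comm]
      have h3 : ∑ x ∈ N, 2 * Fintype.card Y ≤ ∑ x ∈ N, 27 * #{y | R x y} :=
        Finset.sum_le_sum (fun x _ => h x)
      rw [← Finset.mul_sum, h2] at h1
      rw [← Finset.mul_sum, ← Finset.mul_sum] at h3
      simp only [Finset.sum_const, Finset.card_univ, smul_eq_mul] at h1 h3
      nlinarith
    obtain ⟨y, hy⟩ := key
    refine ⟨insert y T, (card_insert_le _ _).trans (by omega), ?_⟩
    have e : ({x | ∀ z ∈ insert y T, ¬ R x z} : Finset X) = {x ∈ N | ¬ R x y} := by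
      ext x
      simp [hN, and_comm]
    rw [e]
    have hs := Finset.card_filter_add_card_filter_not (s := N) (fun x => R x y)
    have h4 : 27 * #{x ∈ N | ¬ R x y} ≤ 25 * #N := by omega
    calc 27 ^ (k+1) * #{x ∈ N | ¬ R x y} = 27 ^ k * (27 * #{x ∈ N | ¬ R x y}) := by ring
      _ ≤ 27 ^ k * (25 * #N) := Nat.mul_le_mul_left _ h4
      _ = 25 * (27 ^ k * #N) := by ring
      _ ≤ 25 * (25 ^ k * Fintype.card X) := Nat.mul_le_mul_left _ hc
      _ = _ := by ring

open Finset in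
theorem count_transitive {G X : Type*} [Group G] [Fintype G] [Fintype X] [DecidableEq X]
    [MulAction G X] [MulAction.IsPretransitive G X] (U : Finset X) (x : X) :
    Fintype.card G * #U = Fintype.card X * #{g : G | g • x ∈ U} := by
  have hc : ∀ u : X, #{g : G | g • x = u} = #{g : G | g • x = x} := by
    intro u
    obtain ⟨t, ht⟩ := MulAction.exists_smul_eq G x u
    refine Finset.card_bij (fun g _ => t⁻¹ * g) ?_ ?_ ?_
    · intro g hg
      simp only [mem_filter, mem_univ, true_and] at hg ⊢
      rw [mul_smul, hg, ← ht, inv_smul_smul]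
    · intro a _ b _ hab
      exact mul_left_cancel hab
    · intro g hg
      simp only [mem_filter, mem_univ, true_and] at hg
      refine ⟨t * g, ?_, by group⟩
      simp only [mem_filter, mem_univ, true_and]
      rw [mul_smul, hg, ht]
  have h1 : ∀ V : Finset X, #{g : G | g • x ∈ V} = #V * #{g : G | g • x = x} := by
    intro V
    rw [Finset.card_eq_sum_card_fiberwise (f := fun g => g • x) (t := V)
      (fun g hg => by simpa using hg)]
    rw [Finset.sum_congr rfl (g := fun _ => #{g : G | g • x = x})]
    · simp
    · intro u hu
      rw [← hc u]
      congr 1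
      ext g
      simp only [mem_filter, mem_univ, true_and]
      constructor
      · exact fun h => h.2
      · intro h; exact ⟨h ▸ hu, h⟩
  have h2 := h1 univ
  simp only [mem_univ, filter_true, card_univ] at h2
  rw [h1, h2]; ring

open Finset in
theorem exists_small {G X : Type*} [Group G] [Fintype G] [Fintype X] [DecidableEq X]
    [DecidableEq G]
    [MulAction G X] [MulAction.IsPretransitive G X] (U : Finset X) (n : ℕ) (hn : 4 ≤ n)
    (hX : Fintype.card X ≤ n ^ 4) (hU : 2 * Fintype.card X ≤ 27 * #U) :
    ∃ T : Finset G, #T ≤ 60 * Nat.log 2 n ∧ ∀ x : X, ∃ g ∈ T, g • x ∈ U := by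
  have hR : ∀ x : X, 2 * Fintype.card G ≤ 27 * #{g : G | g • x ∈ U} := by
    intro x
    have := count_transitive (G := G) U x
    have hp : 0 < Fintype.card X := Fintype.card_pos_iff.2 ⟨x⟩
    refine Nat.le_of_mul_le_mul_left ?_ hp
    calc Fintype.card X * (2 * Fintype.card G) = Fintype.card G * (2 * Fintype.card X) := by ring
      _ ≤ Fintype.card G * (27 * #U) := Nat.mul_le_mul_left _ hU
      _ = 27 * (Fintype.card G * #U) := by ring
      _ = _ := by rw [this]; ring
  obtain ⟨T, hT, hc⟩ := greedy_aux (fun (x : X) (g : G) => g • x ∈ U) hR (60 * Nat.log 2 n)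
  refine ⟨T, hT, ?_⟩
  by_contra! hcon
  obtain ⟨x, hx⟩ := hcon
  have h1 : 1 ≤ #{x : X | ∀ g ∈ T, ¬ g • x ∈ U} := by
    rw [Nat.one_le_iff_ne_zero, ← Nat.pos_iff_ne_zero, Finset.card_pos]
    exact ⟨x, by simpa using hx⟩
  set l := Nat.log 2 n with hl
  have hl2 : 2 ≤ l := by
    have : Nat.log 2 4 ≤ Nat.log 2 n := Nat.log_mono_right hn
    have h4 : Nat.log 2 4 = 2 := by
      rw [show (4:ℕ) = 2^2 by norm_num, Nat.log_pow (by norm_num)]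
    omega
  have hn2 : n < 2 ^ (l+1) := Nat.lt_pow_succ_log_self (by norm_num) n
  have h2 : (27:ℕ) ^ (60 * l) ≤ 25 ^ (60 * l) * n ^ 4 := by
    calc (27:ℕ) ^ (60 * l) ≤ 27 ^ (60*l) * _ := Nat.le_mul_of_pos_right _ h1
      _ ≤ _ := hc
      _ ≤ _ := Nat.mul_le_mul_left _ hX
  have h3 : (25:ℕ) ^ (60 * l) * 2 ^ (6 * l) ≤ 27 ^ (60 * l) := by
    rw [show 60 * l = 10 * (6 * l) by ring, pow_mul, ← mul_pow, pow_mul 27 10]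
    exact Nat.pow_le_pow_left (by norm_num) _
  have h4 : n ^ 4 < 2 ^ (6 * l) := by
    calc n ^ 4 < (2 ^ (l+1)) ^ 4 := Nat.pow_lt_pow_left hn2 (by norm_num)
      _ = 2 ^ ((l+1) * 4) := by rw [pow_mul]
      _ ≤ _ := Nat.pow_le_pow_right (by norm_num) (by omega)
  have h5 : (25:ℕ) ^ (60 * l) * n ^ 4 < 25 ^ (60 * l) * 2 ^ (6 * l) :=
    Nat.mul_lt_mul_of_pos_left h4 (by positivity)
  omega

/-- the prime used -/
theorem exists_good_prime (n : ℕ) (hn : 5 ≤ n) (h6 : n ≠ 6) :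
    ∃ p, p.Prime ∧ 3 ≤ p ∧ n < 6 * p ∧ 2 * p ≤ n + 1 ∧ ¬ p ∣ n := by
  by_cases hs : n ≤ 19
  · have : n ∈ ({5,7,8,9,10,11,12,13,14,15,16,17,18,19} : Finset ℕ) := by
      simp; omega
    by_cases h9 : n = 5 ∨ n = 7 ∨ n = 8 ∨ n = 10 ∨ n = 11 ∨ n = 13 ∨ n = 14 ∨ n = 16 ∨ n = 17
    · by_cases h17 : n = 17
      · exact ⟨5, by norm_num, by norm_num, by omega, by omega, by omega⟩
      · exact ⟨3, by norm_num, by norm_num, by omega, by omega, by omega⟩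
    · by_cases h15 : n = 15
      · exact ⟨7, by norm_num, by norm_num, by omega, by omega, by omega⟩
      · exact ⟨5, by norm_num, by norm_num, by omega, by omega, by omega⟩
  · obtain ⟨p, hp, h1, h2⟩ := Nat.exists_prime_lt_and_le_two_mul (n / 4) (by omega)
    by_cases hd : p ∣ n
    · obtain ⟨q, hq, h3, h4⟩ := Nat.exists_prime_lt_and_le_two_mul ((p-1)/2) (by omega)
      obtain ⟨c, hc⟩ := hd
      have hc4 : c < 4 := by
        by_contra! hcon
        have : p * 4 ≤ p * c := Nat.mul_le_mul_left _ hcon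
        omega
      refine ⟨q, hq, by omega, ?_, by omega, ?_⟩
      · have : p * c ≤ p * 3 := Nat.mul_le_mul_left _ (by omega)
        have hodd := hp.eq_two_or_odd
        omega
      · intro hqn
        rw [hc] at hqn
        rcases (hq.dvd_mul).1 hqn with h | h
        · have := (Nat.prime_dvd_prime_iff_eq hq hp).1 h
          omega
        · have : 0 < c := by
            rcases Nat.eq_zero_or_pos c with h0 | h0
            · subst h0; omega
            · exact h0
          have := Nat.le_of_dvd this h
          have : p * c ≤ p * 3 := Nat.mul_le_mul_left _ (by omega)
          have hodd := hp.eq_two_or_odd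
          omega
    · exact ⟨p, hp, by omega, by omega, by omega, hd⟩

end AUD
namespace AUD

theorem perm_apply_inv_self {α : Type*} (g : Equiv.Perm α) (x : α) : g (g⁻¹ x) = x :=
  g.apply_symm_apply x

open Equiv Equiv.Perm in
theorem comm_isThreeCycle {α : Type*} [Fintype α] [DecidableEq α] (g h : Perm α) (w : α)
    (hg : g w ≠ w) (hh : h w ≠ w) (hw : ∀ x, g x ≠ x → h x ≠ x → x = w) :
    (g * h * g⁻¹ * h⁻¹).IsThreeCycle := by
  have hgm : ∀ x, g x ≠ x → g (g x) ≠ g x := fun x hx h' => hx (g.injective h')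
  have hhm : ∀ x, h x ≠ x → h (h x) ≠ h x := fun x hx h' => hx (h.injective h')
  have hgi : ∀ x, g x ≠ x → g (g⁻¹ x) ≠ g⁻¹ x := by
    intro x hx h'
    rw [perm_apply_inv_self] at h'
    apply hx; conv_lhs => rw [h']
    simp
  have hhi : ∀ x, h x ≠ x → h (h⁻¹ x) ≠ h⁻¹ x := by
    intro x hx h'
    rw [perm_apply_inv_self] at h'
    apply hx; conv_lhs => rw [h']
    simp
  have hgf : ∀ x, g x = x → g⁻¹ x = x := fun x hx => by rw [Perm.inv_eq_iff_eq, hx]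
  have hhf : ∀ x, h x = x → h⁻¹ x = x := fun x hx => by rw [Perm.inv_eq_iff_eq, hx]
  have hgh : ∀ x, g x ≠ x → x ≠ w → h x = x := fun x h1 h2 => by
    by_contra h3; exact h2 (hw x h1 h3)
  have hhg : ∀ x, h x ≠ x → x ≠ w → g x = x := fun x h1 h2 => by
    by_contra h3; exact h2 (hw x h3 h1)
  have hne : h w ≠ g w := by
    intro h'
    have := hw (g w) (hgm w hg) (by rw [← h']; exact hhm w hh)
    exact hg this
  have e : g * h * g⁻¹ * h⁻¹ = swap w (h w) * swap w (g w) := by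
    ext x
    simp only [Perm.mul_apply]
    by_cases hxw : x = w
    · subst hxw
      rw [swap_apply_left, swap_apply_of_ne_of_ne hg hne.symm]
      have h1 := hhi x hh
      have h2 : h⁻¹ x ≠ x := fun h' => by rw [Perm.inv_eq_iff_eq] at h'; exact hh h'.symm
      rw [hgf _ (hhg _ h1 h2), perm_apply_inv_self]
    by_cases hxg : g x = x
    · by_cases hxh : h x = x
      · rw [hhf x hxh, hgf x hxg, hxh, hxg, swap_apply_of_ne_of_ne hxw, swap_apply_of_ne_of_ne hxw]
        · rintro rfl; exact hhm w hh hxh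
        · rintro rfl; exact hgm w hg hxg
      · have h1 := hhi x hxh
        by_cases h2 : h⁻¹ x = w
        · have h3 : x = h w := by rw [← h2]; simp
          rw [h2]
          have h4 : g⁻¹ w ≠ w := fun h' => by rw [Perm.inv_eq_iff_eq] at h'; exact hg h'.symm
          rw [hgh _ (hgi w hg) h4, perm_apply_inv_self, h3,
            swap_apply_of_ne_of_ne hh hne, swap_apply_right]
        · rw [hgf _ (hhg _ h1 h2), perm_apply_inv_self, hxg,
            swap_apply_of_ne_of_ne hxw, swap_apply_of_ne_of_ne hxw]
          · rintro rfl; exact h2 (by simp)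
          · rintro rfl; exact hgm w hg hxg
    · have hxh : h x = x := hgh x hxg hxw
      rw [hhf x hxh]
      by_cases h2 : g⁻¹ x = w
      · have h3 : x = g w := by rw [← h2]; simp
        rw [h2, hhg (h w) (hhm w hh) hh, h3, swap_apply_right, swap_apply_left]
      · rw [hgh _ (hgi x hxg) h2, perm_apply_inv_self,
          swap_apply_of_ne_of_ne hxw, swap_apply_of_ne_of_ne hxw]
        · rintro rfl; exact hhm w hh hxh
        · rintro rfl; exact h2 (by simp)
  rw [e]
  exact isThreeCycle_swap_mul_swap_same hh.symm hg.symm hne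

open Equiv Equiv.Perm MulAction in
theorem jordan_prime {α : Type*} [Fintype α] [DecidableEq α] (G : Subgroup (Perm α))
    (hG : IsPreprimitive G α) {g : Perm α} (hgc : g.IsCycle) (hg : g ∈ G)
    (hp : (g.support.card).Prime) (h2 : 2 * g.support.card ≤ Fintype.card α + 1)
    (hn : 4 ≤ Fintype.card α) :
    alternatingGroup α ≤ G := by
  classical
  have hp2 := hp.two_le
  set p := g.support.card with hpdef
  have hcompl : ((g.support : Set α)ᶜ).ncard = Fintype.card α - p := by
    rw [Set.ncard_compl, Set.ncard_coe_finset, Nat.card_eq_fintype_card]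
  obtain ⟨m, hm⟩ : ∃ m, Fintype.card α - p = m + 1 := ⟨Fintype.card α - p - 1, by omega⟩
  have hprim : IsPreprimitive (fixingSubgroup G (g.support : Set α)ᶜ)
      (SubMulAction.ofFixingSubgroup G (g.support : Set α)ᶜ) := by
    have := isPretransitive_of_isCycle_mem hgc hg
    apply IsPreprimitive.of_prime_card
    convert! hp
    rw [Nat.card_eq_fintype_card, Fintype.card_subtype, hpdef]
    apply congr_arg
    ext x
    simp [SubMulAction.mem_ofFixingSubgroup_iff]
  have hmul : IsMultiplyPreprimitive G α (m + 2) :=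
    IsPreprimitive.isMultiplyPreprimitive hG (hcompl.trans hm)
      (by rw [Nat.card_eq_fintype_card]; omega) hprim
  have hpt : IsMultiplyPretransitive G α p :=
    isMultiplyPretransitive_of_le (n := m + 2) (by omega)
      (by rw [Nat.card_eq_fintype_card]; omega)
  -- choose embeddings
  obtain ⟨w, hw⟩ : ∃ w, g w ≠ w := by
    obtain ⟨w, hw, _⟩ := hgc
    exact ⟨w, hw⟩
  obtain ⟨D, hD, hDc⟩ : ∃ D ⊆ (g.support)ᶜ, D.card = p - 1 :=
    Finset.exists_subset_card_eq (by rw [Finset.card_compl]; omega)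
  have hwD : w ∉ D := fun h => by
    have := hD h
    simp at this
    exact hw this
  let e1 : Fin p ↪ α := (g.support.equivFin.symm.toEmbedding).trans (Function.Embedding.subtype _)
  have hc2 : (insert w D).card = p := by
    rw [Finset.card_insert_of_notMem hwD]; omega
  let e2 : Fin p ↪ α := (((insert w D).equivFinOfCardEq hc2).symm.toEmbedding).trans
    (Function.Embedding.subtype _)
  obtain ⟨k, hk⟩ := MulAction.exists_smul_eq G e1 e2
  have himg : ∀ x, g x ≠ x → (k : Perm α) x ∈ insert w D := by
    intro x hx
    have hx' : x ∈ g.support := by simpa using hx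
    have h1 : e1 (g.support.equivFin ⟨x, hx'⟩) = x := by simp [e1]
    have h3 : (k : Perm α) x = e2 (g.support.equivFin ⟨x, hx'⟩) := by
      rw [← hk]
      conv_lhs => rw [← h1]
      rfl
    rw [h3]
    simp only [e2, Function.Embedding.trans_apply]
    exact (((insert w D).equivFinOfCardEq hc2).symm _).2
  have hsurj : ∃ x, g x ≠ x ∧ (k : Perm α) x = w := by
    have h1 : e2 (((insert w D).equivFinOfCardEq hc2) ⟨w, by simp⟩) = w := by simp [e2]
    refine ⟨e1 (((insert w D).equivFinOfCardEq hc2) ⟨w, by simp⟩), ?_, ?_⟩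
    · have := (g.support.equivFin.symm (((insert w D).equivFinOfCardEq hc2) ⟨w, by simp⟩)).2
      exact Perm.mem_support.1 this
    · conv_rhs => rw [← h1, ← hk]
      rfl
  refine alternatingGroup_le_of_isPreprimitive_of_isThreeCycle_mem hG
    (g := g * (k * g * (k:Perm α)⁻¹) * g⁻¹ * (k * g * (k:Perm α)⁻¹)⁻¹) ?_ ?_
  · apply comm_isThreeCycle _ _ w hw
    · obtain ⟨x, hx, hkx⟩ := hsurj
      rw [← hkx]
      simpa using hx
    · intro x hx hx'
      have h5 : g ((k:Perm α)⁻¹ x) ≠ (k:Perm α)⁻¹ x := by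
        intro h'
        apply hx'
        rw [Perm.mul_apply, Perm.mul_apply, h', perm_apply_inv_self]
      have h6 := himg _ h5
      rw [perm_apply_inv_self, Finset.mem_insert] at h6
      rcases h6 with h6 | h6
      · exact h6
      · have := hD h6
        simp at this
        exact absurd this hx
  · have hk' := k.2
    have : (k * g * (k:Perm α)⁻¹) ∈ G := G.mul_mem (G.mul_mem hk' hg) (G.inv_mem hk')
    exact G.mul_mem (G.mul_mem (G.mul_mem hg this) (G.inv_mem hg)) (G.inv_mem this)

end AUD
namespace AUD

/-- `s` has cycles exactly the nonempty fibres of `l`; the fibre over `0` has size `p`, the other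
nonempty fibres have size `a`. -/
structure Good {n : ℕ} (p a : ℕ) (s : Equiv.Perm (Fin n)) (l : Fin n → Fin 3) : Prop where
  inv : ∀ x, l (s x) = l x
  cyc : ∀ x y, l x = l y → ∃ k : ℕ, (s ^ k) x = y
  c0 : (Finset.univ.filter (fun x => l x = 0)).card = p
  c1 : ∀ x, l x ≠ 0 → (Finset.univ.filter (fun y => l y = l x)).card = a
  per0 : ∀ x, l x = 0 → (s ^ p) x = x
  per1 : ∀ x, l x ≠ 0 → (s ^ a) x = x

theorem Good.conj {n p a : ℕ} {s : Equiv.Perm (Fin n)} {l : Fin n → Fin 3} (h : Good p a s l)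
    (t : Equiv.Perm (Fin n)) : Good p a (t⁻¹ * s * t) (l ∘ t) := by
  have hpow : ∀ k : ℕ, ∀ x, ((t⁻¹ * s * t) ^ k) x = t⁻¹ ((s ^ k) (t x)) := by
    intro k x
    have : (t⁻¹ * s * t) ^ k = t⁻¹ * s ^ k * t := by
      have := conj_pow (i := k) (a := t⁻¹) (b := s)
      simpa using this
    rw [this]; rfl
  have hcard : ∀ i, (Finset.univ.filter (fun x => (l ∘ t) x = i)).card =
      (Finset.univ.filter (fun x => l x = i)).card := by
    intro i
    refine Finset.card_bij (fun x _ => t x) ?_ ?_ ?_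
    · intro x hx; simpa using hx
    · intro x _ y _ hxy; exact t.injective hxy
    · intro y hy
      refine ⟨t⁻¹ y, ?_, perm_apply_inv_self _ _⟩
      simp only [Finset.mem_filter, Finset.mem_univ, true_and, Function.comp] at hy ⊢
      rwa [perm_apply_inv_self]
  constructor
  · intro x
    simp only [Function.comp, Equiv.Perm.mul_apply, perm_apply_inv_self]
    exact h.inv _
  · intro x y hxy
    obtain ⟨k, hk⟩ := h.cyc _ _ hxy
    refine ⟨k, ?_⟩
    rw [hpow, hk]
    exact t.symm_apply_apply y
  · rw [hcard]; exact h.c0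
  · intro x hx
    rw [hcard]; exact h.c1 _ hx
  · intro x hx
    rw [hpow, h.per0 _ hx]
    exact t.symm_apply_apply x
  · intro x hx
    rw [hpow, h.per1 _ hx]
    exact t.symm_apply_apply x

theorem Good.zpow_inv {n p a : ℕ} {s : Equiv.Perm (Fin n)} {l : Fin n → Fin 3} (h : Good p a s l)
    (k : ℕ) (x : Fin n) : l ((s ^ k) x) = l x := by
  induction k with
  | zero => simp
  | succ k ih => rw [pow_succ', Equiv.Perm.mul_apply, h.inv, ih]

theorem Good.reach {n p a : ℕ} {s : Equiv.Perm (Fin n)} {l : Fin n → Fin 3} (h : Good p a s l)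
    (m : ℕ) (hm : Nat.Coprime m p) (x y : Fin n) (hx : l x = 0) (hy : l y = 0) :
    ∃ j : ℤ, ((s ^ m) ^ j) x = y := by
  obtain ⟨k, hk⟩ := h.cyc x y (hx.trans hy.symm)
  have hb := Nat.gcd_eq_gcd_ab m p
  rw [hm] at hb
  refine ⟨Nat.gcdA m p * k, ?_⟩
  have hper : ∀ z : ℤ, ((s ^ p) ^ z) x = x := fun z =>
    Equiv.Perm.zpow_apply_eq_self_of_apply_eq_self (h.per0 x hx) z
  have e : s ^ k = (s ^ m) ^ (Nat.gcdA m p * k) * (s ^ p) ^ (Nat.gcdB m p * k) := by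
    rw [← zpow_natCast s m, ← zpow_natCast s p, ← zpow_mul, ← zpow_mul, ← zpow_add,
      ← zpow_natCast s k]
    congr 1
    push_cast at hb
    linear_combination (k:ℤ) * hb
  rw [e, Equiv.Perm.mul_apply, hper] at hk
  exact hk

open Equiv Equiv.Perm MulAction in
theorem Good.isCycle {n p a : ℕ} {s : Perm (Fin n)} {l : Fin n → Fin 3} (h : Good p a s l)
    (hp : 2 ≤ p) (hpa : Nat.Coprime a p) :
    (s ^ a).IsCycle ∧ (s ^ a).support.card = p := by
  have hmove : ∀ x, l x = 0 → (s ^ a) x ≠ x := by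
    intro x hx hfix
    have : (Finset.univ.filter (fun x => l x = 0)) ⊆ {x} := by
      intro y hy
      simp only [Finset.mem_filter, Finset.mem_univ, true_and] at hy
      obtain ⟨j, hj⟩ := h.reach a hpa x y hx hy
      rw [zpow_apply_eq_self_of_apply_eq_self hfix] at hj
      simp [hj]
    have := Finset.card_le_card this
    rw [h.c0] at this
    simp at this
    omega
  have hsupp : (s ^ a).support = Finset.univ.filter (fun x => l x = 0) := by
    ext x
    simp only [Perm.mem_support, Finset.mem_filter, Finset.mem_univ, true_and]
    constructor
    · intro hx
      by_contra h0
      exact hx (h.per1 x h0)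
    · exact hmove x
  refine ⟨?_, by rw [hsupp, h.c0]⟩
  obtain ⟨z, hz⟩ : (Finset.univ.filter (fun x => l x = 0)).Nonempty := by
    rw [← Finset.card_pos, h.c0]; omega
  simp only [Finset.mem_filter, Finset.mem_univ, true_and] at hz
  refine ⟨z, hmove z hz, ?_⟩
  intro y hy
  have : l y = 0 := by
    by_contra h0
    exact hy (h.per1 y h0)
  exact h.reach a hpa z y hz this

open Equiv Equiv.Perm MulAction Pointwise in
theorem Good.preprimitive {n p a : ℕ} {s : Perm (Fin n)} {l : Fin n → Fin 3} (h : Good p a s l)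
    (hp : p.Prime) (hpa : Nat.Coprime a p) (hpn : ¬ p ∣ n) (hn : n < 2 * (p + a))
    (H : Subgroup (Perm (Fin n))) (hs : s ∈ H) (hH : IsPretransitive H (Fin n)) :
    IsPreprimitive H (Fin n) := by
  obtain ⟨z, hz⟩ : (Finset.univ.filter (fun x => l x = 0)).Nonempty := by
    rw [← Finset.card_pos, h.c0]; exact hp.pos
  simp only [Finset.mem_filter, Finset.mem_univ, true_and] at hz
  apply IsPreprimitive.of_isTrivialBlock_base z
  intro B hzB hB
  rcases B.subsingleton_or_nontrivial with hsub | hnt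
  · left; exact hsub
  right
  obtain ⟨w, hwB, hwz⟩ := hnt.exists_ne z
  -- some good power of s preserves B
  have closed : ∀ t : Perm (Fin n), t ∈ H → ∀ u ∈ B, t u ∈ B → ∀ j : ℤ, ∀ v ∈ B,
      (t ^ j) v ∈ B := by
    intro t ht u hu htu j v hv
    have h1 : (⟨t, ht⟩ : H) • B = B := hB.smul_eq_of_mem hu htu
    have h2 : (⟨t, ht⟩ : H) ∈ stabilizer H B := h1
    have h3 : (⟨t, ht⟩ : H) ^ j ∈ stabilizer H B := Subgroup.zpow_mem _ h2 j
    have h4 : ((⟨t, ht⟩ : H) ^ j) • B = B := h3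
    have h5 : ((⟨t, ht⟩ : H) ^ j) • v ∈ ((⟨t, ht⟩ : H) ^ j) • B := Set.smul_mem_smul_set hv
    rw [h4] at h5
    have e : ((⟨t, ht⟩ : H) ^ j) • v = (t ^ j) v := by
      rw [Subgroup.smul_def, Subgroup.coe_zpow]; rfl
    rwa [e] at h5
  have hm : ∃ m : ℕ, Nat.Coprime m p ∧ ∃ u ∈ B, (s ^ m) u ∈ B := by
    by_cases hw0 : l w = 0
    · obtain ⟨k, hk⟩ := h.cyc z w (hz.trans hw0.symm)
      refine ⟨k, ?_, z, hzB, by rw [hk]; exact hwB⟩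
      rw [Nat.coprime_comm, hp.coprime_iff_not_dvd]
      rintro ⟨c, rfl⟩
      apply hwz
      rw [← hk, pow_mul]
      exact pow_apply_eq_self_of_apply_eq_self (h.per0 z hz) c
    · exact ⟨a, hpa, w, hwB, by rw [h.per1 w hw0]; exact hwB⟩
  obtain ⟨m, hmp, u, huB, hsu⟩ := hm
  have hP : ∀ y, l y = 0 → y ∈ B := by
    intro y hy
    obtain ⟨j, hj⟩ := h.reach m hmp z y hz hy
    rw [← hj]
    exact closed _ (H.pow_mem hs m) u huB hsu j z hzB
  have hsat : ∀ x ∈ B, ∀ y, l x = l y → y ∈ B := by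
    intro x hx y hxy
    obtain ⟨k, hk⟩ := h.cyc x y hxy
    have := closed s hs z hzB (hP _ (by rw [h.inv, hz])) k x hx
    rw [zpow_natCast, hk] at this
    exact this
  by_cases hex : ∃ x ∈ B, l x ≠ 0
  · obtain ⟨x, hxB, hx0⟩ := hex
    apply hB.eq_univ_of_card_lt
    have hsubs : ((Finset.univ.filter (fun y => l y = 0) ∪
        Finset.univ.filter (fun y => l y = l x) : Finset (Fin n)) : Set (Fin n)) ⊆ B := by
      intro y hy
      simp only [Finset.coe_union, Finset.coe_filter, Finset.mem_univ, true_and, Set.mem_union,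
        Set.mem_ofPred_eq] at hy
      rcases hy with hy | hy
      · exact hP y hy
      · exact hsat x hxB y hy.symm
    have h1 := Set.ncard_le_ncard hsubs (Set.toFinite B)
    rw [Set.ncard_coe_finset, Finset.card_union_of_disjoint, h.c0, h.c1 x hx0] at h1
    · rw [Nat.card_eq_fintype_card, Fintype.card_fin]; omega
    · rw [Finset.disjoint_filter]
      intro y _ hy hy'
      exact hx0 (hy'.symm.trans hy)
  · exfalso
    push Not at hex
    have hBe : B = ((Finset.univ.filter (fun y => l y = 0) : Finset (Fin n)) : Set (Fin n)) := by
      ext y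
      simp only [Finset.coe_filter, Finset.mem_univ, true_and, Set.mem_ofPred_eq]
      exact ⟨hex y, hP y⟩
    have := hB.ncard_dvd_card ⟨z, hzB⟩
    rw [hBe, Set.ncard_coe_finset, h.c0, Nat.card_eq_fintype_card, Fintype.card_fin] at this
    exact hpn this

open Equiv Equiv.Perm MulAction in
theorem Good.alternating_le {n p a : ℕ} {s : Perm (Fin n)} {l : Fin n → Fin 3} (h : Good p a s l)
    (hp : p.Prime) (hpa : Nat.Coprime a p) (hpn : ¬ p ∣ n) (hn : n < 2 * (p + a))
    (h2 : 2 * p ≤ n + 1) (hn4 : 4 ≤ n)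
    (H : Subgroup (Perm (Fin n))) (hs : s ∈ H) (hH : IsPretransitive H (Fin n)) :
    alternatingGroup (Fin n) ≤ H := by
  obtain ⟨hc, hsup⟩ := h.isCycle hp.two_le hpa
  exact jordan_prime H (h.preprimitive hp hpa hpn hn H hs hH) hc (H.pow_mem hs a)
    (by rw [hsup]; exact hp) (by rw [hsup, Fintype.card_fin]; exact h2)
    (by rw [Fintype.card_fin]; exact hn4)

open Equiv Equiv.Perm MulAction in
theorem Good.pretransitive {n p a : ℕ} {s : Perm (Fin n)} {l : Fin n → Fin 3} (h : Good p a s l)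
    (H : Subgroup (Perm (Fin n))) (hs : s ∈ H) (u : Fin n)
    (hu : ∀ z, ∃ t ∈ H, l (t u) = l z) : IsPretransitive H (Fin n) := by
  suffices hz : ∀ z : Fin n, ∃ g : H, g • u = z by
    refine ⟨fun z z' => ?_⟩
    obtain ⟨g, hg⟩ := hz z
    obtain ⟨g', hg'⟩ := hz z'
    exact ⟨g' * g⁻¹, by rw [mul_smul, ← hg, inv_smul_smul, hg']⟩
  intro z
  obtain ⟨t, ht, htz⟩ := hu z
  obtain ⟨k, hk⟩ := h.cyc _ _ htz
  exact ⟨⟨s ^ k * t, H.mul_mem (H.pow_mem hs k) ht⟩, hk⟩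

open Equiv Equiv.Perm in
theorem alt_closure_top {n : ℕ} (x y : alternatingGroup (Fin n))
    (h : alternatingGroup (Fin n) ≤ Subgroup.closure {(x : Perm (Fin n)), (y : Perm (Fin n))}) :
    Subgroup.closure {x, y} = ⊤ := by
  rw [eq_top_iff]
  have hm : (Subgroup.closure {x, y}).map (alternatingGroup (Fin n)).subtype =
      Subgroup.closure {(x : Perm (Fin n)), (y : Perm (Fin n))} := by
    rw [MonoidHom.map_closure, Set.image_pair]
    rfl
  intro g _
  have := h g.2
  rw [← hm] at this
  obtain ⟨g', hg', he⟩ := this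
  have : g' = g := Subtype.ext he
  rwa [← this]

end AUD
namespace AUD

theorem finRotate_pow_apply (m k : ℕ) (i : Fin (m+1)) :
    ((finRotate (m+1)) ^ k) i = i + (Fin.ofNat (m+1) k) := by
  induction k with
  | zero => simp
  | succ k ih =>
    rw [pow_succ', Equiv.Perm.mul_apply, ih, finRotate_succ_apply]
    ext
    simp [Fin.val_add]
    ring_nf

theorem finRotate_pow_self (m : ℕ) (i : Fin m) : ((finRotate m) ^ m) i = i := by
  cases m with
  | zero => exact i.elim0
  | succ m =>
    rw [finRotate_pow_apply]
    ext
    simp [Fin.val_add]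

theorem finRotate_reach (m : ℕ) (i j : Fin m) : ∃ k : ℕ, ((finRotate m) ^ k) i = j := by
  cases m with
  | zero => exact i.elim0
  | succ m =>
    refine ⟨(j - i).val, ?_⟩
    rw [finRotate_pow_apply]
    simp

open Equiv Equiv.Perm in
theorem sumCongr_pow_apply {α β : Type*} (f : Perm α) (g : Perm β) (k : ℕ) (x : α ⊕ β) :
    ((Perm.sumCongr f g) ^ k) x = (Perm.sumCongr (f ^ k) (g ^ k)) x := by
  induction k with
  | zero => simp
  | succ k ih =>
    rw [pow_succ', Perm.mul_apply, ih, pow_succ', pow_succ']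
    cases x <;> simp

open Equiv Equiv.Perm in
theorem exists_good (n p a b : ℕ) (hn : p + (a + b) = n) (hb : b = 0 ∨ b = a) (hp : 1 ≤ p)
    (ha : 1 ≤ a) :
    ∃ (s : Perm (Fin n)) (l : Fin n → Fin 3), Good p a s l ∧
      sign s = (-1) ^ (p - 1) * ((-1) ^ (a - 1) * (-1) ^ (b - 1)) ∧
      (Finset.univ.filter (fun x => l x = 1)).card = a ∧
      (Finset.univ.filter (fun x => l x = 2)).card = b := by
  classical
  let e : Fin n ≃ Fin p ⊕ (Fin a ⊕ Fin b) := Fintype.equivOfCardEq (by simp [hn])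
  let s0 : Perm (Fin p ⊕ (Fin a ⊕ Fin b)) :=
    Perm.sumCongr (finRotate p) (Perm.sumCongr (finRotate a) (finRotate b))
  let l0 : Fin p ⊕ (Fin a ⊕ Fin b) → Fin 3 :=
    Sum.elim (fun _ => 0) (Sum.elim (fun _ => 1) (fun _ => 2))
  let s : Perm (Fin n) := e.symm.permCongr s0
  have hpow : ∀ (k : ℕ) x, (s ^ k) x = e.symm ((s0 ^ k) (e x)) := by
    intro k x
    induction k with
    | zero => simp
    | succ k ih =>
      rw [pow_succ', Perm.mul_apply, ih, pow_succ', Perm.mul_apply]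
      simp [s]
  have hcard : ∀ i, (Finset.univ.filter (fun x => l0 (e x) = i)).card =
      (Finset.univ.filter (fun x => l0 x = i)).card := by
    intro i
    refine Finset.card_bij (fun x _ => e x) ?_ ?_ ?_
    · intro x hx; simpa using hx
    · intro x _ y _ hxy; exact e.injective hxy
    · intro y hy
      exact ⟨e.symm y, by simpa using hy, by simp⟩
  have hk0 : (Finset.univ.filter (fun x => l0 x = 0)).card = p := by
    have : (Finset.univ.filter (fun x => l0 x = 0)) =
      (Finset.univ : Finset (Fin p)).map ⟨Sum.inl, Sum.inl_injective⟩ := by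
      ext x
      rcases x with i | i | i <;> simp [l0]
    rw [this]; simp
  have hk1 : (Finset.univ.filter (fun x => l0 x = 1)).card = a := by
    have : (Finset.univ.filter (fun x => l0 x = 1)) =
      (Finset.univ : Finset (Fin a)).map
        ⟨fun i => Sum.inr (Sum.inl i), Sum.inr_injective.comp Sum.inl_injective⟩ := by
      ext x
      rcases x with i | i | i <;> simp [l0]
    rw [this]; simp
  have hk2 : (Finset.univ.filter (fun x => l0 x = 2)).card = b := by
    have : (Finset.univ.filter (fun x => l0 x = 2)) =
      (Finset.univ : Finset (Fin b)).map
        ⟨fun i => Sum.inr (Sum.inr i), Sum.inr_injective.comp Sum.inr_injective⟩ := by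
      ext x
      rcases x with i | i | i <;> simp [l0]
    rw [this]; simp
  refine ⟨s, fun x => l0 (e x), ?_, ?_, by rw [hcard, hk1], by rw [hcard, hk2]⟩
  · constructor
    · intro x
      have := hpow 1 x
      rw [pow_one, pow_one] at this
      rw [this, Equiv.apply_symm_apply]
      rcases e x with i | i | i <;> simp [l0, s0]
    · intro x y hxy
      suffices ∃ k : ℕ, (s0 ^ k) (e x) = e y by
        obtain ⟨k, hk⟩ := this
        exact ⟨k, by rw [hpow, hk, Equiv.symm_apply_apply]⟩
      revert hxy
      rcases e x with i | i | i <;> rcases e y with j | j | j <;> simp [l0, s0, sumCongr_pow_apply]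
      all_goals exact finRotate_reach _ _ _
    · rw [hcard, hk0]
    · intro x hx
      rw [hcard]
      revert hx
      rcases e x with i | i | i
      · simp [l0]
      · intro _; exact hk1
      · intro _
        have : l0 (Sum.inr (Sum.inr i)) = 2 := rfl
        rw [this, hk2]
        rcases hb with rfl | rfl
        · exact i.elim0
        · rfl
    · intro x hx
      rw [hpow, Equiv.symm_apply_eq]
      revert hx
      rcases e x with i | i | i <;> simp [l0, s0, sumCongr_pow_apply, finRotate_pow_self]
    · intro x hx
      rw [hpow, Equiv.symm_apply_eq]
      revert hx
      rcases e x with i | i | i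
      · simp [l0]
      · simp [l0, s0, sumCongr_pow_apply, finRotate_pow_self]
      · rcases hb with rfl | rfl
        · exact i.elim0
        · simp [l0, s0, sumCongr_pow_apply, finRotate_pow_self]
  · simp only [s, s0]
    rw [sign_permCongr, sign_sumCongr, sign_sumCongr, sign_finRotate, sign_finRotate,
      sign_finRotate]

end AUD
namespace AUD

theorem sum_label {n : ℕ} (l : Fin n → Fin 3) (w : Fin 3 → ℕ)
    (hw : ∀ c, (Finset.univ.filter (fun x => l x = c)).card = w c) (F : Fin 3 → ℕ) :
    ∑ i, F (l i) = ∑ c, w c * F c := by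
  rw [← Finset.sum_fiberwise Finset.univ l (fun i => F (l i))]
  refine Finset.sum_congr rfl fun c _ => ?_
  rw [Finset.sum_congr rfl (g := fun _ => F c)]
  · rw [Finset.sum_const, hw, smul_eq_mul]
  · intro i hi
    rw [(Finset.mem_filter.1 hi).2]

open Finset in
theorem count_two {n : ℕ} (l : Fin n → Fin 3) (p a : ℕ)
    (h0 : #{x | l x = 0} = p) (h1 : #{x | l x = 1} = a) (h2 : #{x | l x = 2} = 0) :
    2 * (p * a) ≤ #{t : Fin 2 ↪ Fin n | l (t 0) ≠ l (t 1)} := by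
  have hw : ∀ c, #{x | l x = c} = ![p, a, 0] c := by
    intro c; fin_cases c <;> assumption
  have hV : #{x : Fin n × Fin n | l x.1 ≠ l x.2} = 2 * (p * a) := by
    rw [card_filter, Fintype.sum_prod_type]
    have e1 : ∀ i, (∑ j, if l i ≠ l j then 1 else 0) =
        ∑ d, ![p, a, 0] d * (if l i ≠ d then 1 else 0) :=
      fun i => sum_label l _ hw (fun d => if l i ≠ d then 1 else 0)
    simp only [e1]
    rw [sum_label l _ hw (fun c => ∑ d, ![p, a, 0] d * (if c ≠ d then 1 else 0))]
    simp [Fin.sum_univ_three]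
    ring
  rw [← hV]
  refine (card_le_card ?_).trans
    (card_image_le (s := {t : Fin 2 ↪ Fin n | l (t 0) ≠ l (t 1)}) (f := fun t => (t 0, t 1)))
  rintro ⟨i, j⟩ h
  simp only [mem_filter, mem_univ, true_and] at h
  have hij : i ≠ j := fun h' => h (by rw [h'])
  rw [mem_image]
  refine ⟨⟨![i, j], ?_⟩, ?_, ?_⟩
  · intro u v huv
    fin_cases u <;> fin_cases v <;> simp_all
  · exact mem_filter.2 ⟨mem_univ _, h⟩
  · rfl

/-- four point condition -/
def C4 {n : ℕ} (l : Fin n → Fin 3) (i j k m : Fin n) : Prop :=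
  l i ≠ l j ∧ l i ≠ l k ∧ l j ≠ l k ∧ l m ≠ l k

instance {n : ℕ} (l : Fin n → Fin 3) (i j k m : Fin n) : Decidable (C4 l i j k m) := by
  unfold C4; infer_instance

open Finset in
theorem count_four {n : ℕ} (l : Fin n → Fin 3) (p a : ℕ) (hp : 1 ≤ p) (ha : 1 ≤ a)
    (hn : p + (a + a) = n)
    (h0 : #{x | l x = 0} = p) (h1 : #{x | l x = 1} = a) (h2 : #{x | l x = 2} = a) :
    4 * (p * a * a) * (n - 3) ≤
      #{t : Fin 4 ↪ Fin n | C4 l (t 0) (t 1) (t 2) (t 3)} := by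
  have hw : ∀ c, #{x | l x = c} = ![p, a, a] c := by
    intro c; fin_cases c <;> assumption
  set w : Fin 3 → ℕ := ![p, a, a] with hwdef
  have hV : 4 * (p * a * a) * (n - 3) ≤ #{x : Fin n × Fin n × Fin n × Fin n |
      C4 l x.1 x.2.1 x.2.2.1 x.2.2.2 ∧ x.2.2.2 ≠ x.1 ∧ x.2.2.2 ≠ x.2.1} := by
    rw [card_filter, Fintype.sum_prod_type]
    simp only [Fintype.sum_prod_type]
    let F : Fin 3 → Fin 3 → Fin 3 → ℕ := fun c d e =>
      if c ≠ d ∧ c ≠ e ∧ d ≠ e then n - w e - 2 else 0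
    have inner : ∀ i j k, F (l i) (l j) (l k) ≤
        ∑ m, if C4 l i j k m ∧ m ≠ i ∧ m ≠ j then 1 else 0 := by
      intro i j k
      simp only [F]
      split_ifs with hc
      · rw [← card_filter]
        have e : ({m | C4 l i j k m ∧ m ≠ i ∧ m ≠ j} : Finset (Fin n)) =
            (({m | l m = l k} : Finset (Fin n))ᶜ.erase i).erase j := by
          ext m
          simp only [mem_filter, mem_univ, true_and, mem_erase, mem_compl]
          unfold C4
          tauto
        rw [e]
        have q1 := pred_card_le_card_erase (s := ({m | l m = l k} : Finset (Fin n))ᶜ) (a := i)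
        have q2 := pred_card_le_card_erase
          (s := ({m | l m = l k} : Finset (Fin n))ᶜ.erase i) (a := j)
        rw [card_compl, hw, Fintype.card_fin] at q1
        omega
      · exact Nat.zero_le _
    calc 4 * (p * a * a) * (n - 3)
        = ∑ c, w c * ∑ d, w d * ∑ e, w e * F c d e := by
          have e1 : n - p - 2 = 2 * (a - 1) := by omega
          have e2 : n - a - 2 = p + a - 2 := by omega
          simp [Fin.sum_univ_three, F, hwdef, e1, e2]
          obtain ⟨a, rfl⟩ : ∃ a', a = a' + 1 := ⟨a - 1, by omega⟩
          obtain ⟨p, rfl⟩ : ∃ p', p = p' + 1 := ⟨p - 1, by omega⟩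
          have e3 : n - 3 = p + 2 * a := by omega
          have e4 : p + 1 + (a + 1) - 2 = p + a := by omega
          rw [e3, e4]
          simp only [Nat.add_sub_cancel]
          ring
      _ = ∑ i, ∑ j, ∑ k, F (l i) (l j) (l k) := by
          rw [← sum_label l w hw (fun c => ∑ d, w d * ∑ e, w e * F c d e)]
          refine sum_congr rfl fun i _ => ?_
          rw [← sum_label l w hw (fun d => ∑ e, w e * F (l i) d e)]
          refine sum_congr rfl fun j _ => ?_
          rw [← sum_label l w hw (fun e => F (l i) (l j) e)]
      _ ≤ _ := sum_le_sum fun i _ => sum_le_sum fun j _ => sum_le_sum fun k _ => inner i j k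
  refine hV.trans ((card_le_card ?_).trans
    (card_image_le (s := {t : Fin 4 ↪ Fin n | C4 l (t 0) (t 1) (t 2) (t 3)})
      (f := fun t => (t 0, t 1, t 2, t 3))))
  rintro ⟨i, j, k, m⟩ h
  simp only [mem_filter, mem_univ, true_and] at h
  obtain ⟨hC, hmi, hmj⟩ := h
  have hij : i ≠ j := fun h' => hC.1 (by rw [h'])
  have hik : i ≠ k := fun h' => hC.2.1 (by rw [h'])
  have hjk : j ≠ k := fun h' => hC.2.2.1 (by rw [h'])
  have hmk : m ≠ k := fun h' => hC.2.2.2 (by rw [h'])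
  rw [mem_image]
  refine ⟨⟨![i, j, k, m], ?_⟩, ?_, ?_⟩
  · intro u v huv
    fin_cases u <;> fin_cases v <;> first | rfl | (exfalso; simp at huv; first | exact hij huv | exact hik huv | exact hjk huv | exact hmk huv | exact hmi huv | exact hmj huv | exact hij huv.symm | exact hik huv.symm | exact hjk huv.symm | exact hmk huv.symm | exact hmi huv.symm | exact hmj huv.symm)
  · exact mem_filter.2 ⟨mem_univ _, hC⟩
  · rfl

open Equiv Equiv.Perm Finset in
theorem family_two {n : ℕ} (l : Fin n → Fin 3) (p a : ℕ) (hn : p + a = n) (hn5 : 5 ≤ n)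
    (h6 : n < 6 * p) (hp2 : 2 * p ≤ n + 1)
    (h0 : #{x | l x = 0} = p) (h1 : #{x | l x = 1} = a) (h2 : #{x | l x = 2} = 0) :
    ∃ T : Finset (Perm (Fin n)), #T ≤ 60 * Nat.log 2 n ∧
      ∀ i j, i ≠ j → ∃ g ∈ T, l (g i) ≠ l (g j) := by
  have : MulAction.IsPretransitive (Perm (Fin n)) (Fin 2 ↪ Fin n) :=
    Equiv.Perm.isMultiplyPretransitive (Fin n) 2
  have hX : Fintype.card (Fin 2 ↪ Fin n) = n * (n - 1) := by
    simp [Fintype.card_embedding_eq, Nat.descFactorial]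
    ring
  obtain ⟨T, hT, hT'⟩ := exists_small (G := Perm (Fin n))
    ({t : Fin 2 ↪ Fin n | l (t 0) ≠ l (t 1)} : Finset _) n (by omega)
    (by
      rw [hX]
      calc n * (n - 1) ≤ n * n := Nat.mul_le_mul_left _ (by omega)
        _ = n ^ 2 := by ring
        _ ≤ n ^ 4 := Nat.pow_le_pow_right (by omega) (by norm_num))
    (by
      rw [hX]
      refine le_trans ?_ (Nat.mul_le_mul_left 27 (count_two l p a h0 h1 h2))
      calc 2 * (n * (n - 1)) ≤ 2 * (n * n) := by gcongr; omega
        _ ≤ _ := by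
          have ha : a ≤ 5 * p := by omega
          have hp : p ≤ 2 * a := by omega
          rw [← hn]
          nlinarith [Nat.mul_le_mul_left a ha, Nat.mul_le_mul_left p hp])
  refine ⟨T, hT, fun i j hij => ?_⟩
  obtain ⟨g, hg, hU⟩ := hT' ⟨![i, j], by
    intro u v huv
    fin_cases u <;> fin_cases v <;> simp_all⟩
  refine ⟨g, hg, ?_⟩
  exact (mem_filter.1 hU).2

open Equiv Equiv.Perm Finset in
theorem family_four {n : ℕ} (l : Fin n → Fin 3) (p a : ℕ) (hn : p + (a + a) = n) (hn5 : 5 ≤ n)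
    (h6 : n < 6 * p) (hp2 : 2 * p ≤ n + 1)
    (h0 : #{x | l x = 0} = p) (h1 : #{x | l x = 1} = a) (h2 : #{x | l x = 2} = a) :
    ∃ T : Finset (Perm (Fin n)), #T ≤ 60 * Nat.log 2 n ∧
      ∀ i j k m, i ≠ j → i ≠ k → i ≠ m → j ≠ k → j ≠ m → k ≠ m →
        ∃ g ∈ T, C4 l (g i) (g j) (g k) (g m) := by
  have : MulAction.IsPretransitive (Perm (Fin n)) (Fin 4 ↪ Fin n) :=
    Equiv.Perm.isMultiplyPretransitive (Fin n) 4
  have hX : Fintype.card (Fin 4 ↪ Fin n) = n * (n - 1) * (n - 2) * (n - 3) := by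
    simp [Fintype.card_embedding_eq, Nat.descFactorial]
    ring
  obtain ⟨T, hT, hT'⟩ := exists_small (G := Perm (Fin n))
    ({t : Fin 4 ↪ Fin n | C4 l (t 0) (t 1) (t 2) (t 3)} : Finset _) n (by omega)
    (by
      rw [hX]
      calc n * (n - 1) * (n - 2) * (n - 3) ≤ n * n * n * n := by gcongr <;> omega
        _ = n ^ 4 := by ring)
    (by
      rw [hX]
      refine le_trans ?_ (Nat.mul_le_mul_left 27
        (count_four l p a (by omega) (by omega) hn h0 h1 h2))
      have key : n * n * n ≤ 54 * (p * a * a) := by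
        have hp : p ≤ 4 * a := by omega
        have ha : 2 * a ≤ 5 * p := by omega
        rw [← hn]
        zify at hp ha ⊢
        have e1 : (0:ℤ) ≤ 2 * p * p + 20 * p * a - 4 * a * a := by nlinarith
        have e2 := mul_nonneg (sub_nonneg.2 hp) e1
        nlinarith
      calc 2 * (n * (n - 1) * (n - 2) * (n - 3)) ≤ 2 * (n * n * n * (n - 3)) := by
            gcongr <;> omega
        _ = 2 * (n * n * n) * (n - 3) := by ring
        _ ≤ 2 * (54 * (p * a * a)) * (n - 3) := by gcongr
        _ = _ := by ring)
  refine ⟨T, hT, fun i j k m hij hik him hjk hjm hkm => ?_⟩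
  obtain ⟨g, hg, hU⟩ := hT' ⟨![i, j, k, m], by
    intro u v huv
    fin_cases u <;> fin_cases v <;> first | rfl | (exfalso; simp at huv; first | exact hij huv | exact hik huv | exact hjk huv | exact hkm huv | exact him huv | exact hjm huv | exact hij huv.symm | exact hik huv.symm | exact hjk huv.symm | exact hkm huv.symm | exact him huv.symm | exact hjm huv.symm)⟩
  refine ⟨g, hg, ?_⟩
  exact (mem_filter.1 hU).2

end AUD
namespace AUD

open Equiv Equiv.Perm in
/-- combinatorial pattern inside a nontrivial even permutation -/
theorem exists_pattern {n : ℕ} (hn : 5 ≤ n) (x : Perm (Fin n)) (hx : x ≠ 1) (hs : sign x = 1) :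
    ∃ i j k m : Fin n, i ≠ j ∧ i ≠ k ∧ i ≠ m ∧ j ≠ k ∧ j ≠ m ∧ k ≠ m ∧ x i = j ∧
      (x j = k ∨ x k = m) := by
  obtain ⟨i, hi⟩ : ∃ i, x i ≠ i := by
    by_contra! h
    exact hx (Equiv.ext h)
  by_cases hc : x (x i) = i
  · obtain ⟨k, hk⟩ : ∃ k, x k ≠ swap i (x i) k := by
      by_contra! h
      have : x = swap i (x i) := Equiv.ext h
      rw [this, sign_swap hi.symm] at hs
      exact absurd hs (by decide)
    have hki : k ≠ i := by
      rintro rfl; simp at hk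
    have hkj : k ≠ x i := by
      rintro rfl; simp [hc] at hk
    rw [swap_apply_of_ne_of_ne hki hkj] at hk
    refine ⟨i, x i, k, x k, hi.symm, hki.symm, ?_, hkj.symm, ?_, hk.symm, rfl, Or.inr rfl⟩
    · intro h
      apply hkj
      apply x.injective
      rw [hc, ← h]
    · intro h
      exact hki (x.injective h.symm)
  · obtain ⟨m, hm⟩ : ∃ m, m ∉ ({i, x i, x (x i)} : Finset (Fin n)) := by
      by_contra! h
      have h1 : (Finset.univ : Finset (Fin n)) ⊆ {i, x i, x (x i)} := fun z _ => h z
      have h2 := (Finset.card_le_card h1).trans Finset.card_le_three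
      simp at h2
      omega
    simp only [Finset.mem_insert, Finset.mem_singleton, not_or] at hm
    exact ⟨i, x i, x (x i), m, hi.symm, fun h => hc h.symm, fun h => hm.1 h.symm,
      fun h => hi (x.injective h.symm), fun h => hm.2.1 h.symm, fun h => hm.2.2 h.symm,
      rfl, Or.inl rfl⟩

open Equiv Equiv.Perm in
/-- make a permutation even without changing the labelling -/
theorem exists_even {n p a : ℕ} {s : Perm (Fin n)} {l : Fin n → Fin 3} (h : Good p a s l)
    (hp : 2 ≤ p) (g : Perm (Fin n)) : ∃ g' : alternatingGroup (Fin n),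
      ∀ z, l ((g' : Perm (Fin n)) z) = l (g z) := by
  have hcard : 1 < (Finset.univ.filter (fun x => l x = 0)).card := by rw [h.c0]; omega
  obtain ⟨u, hu, v, hv, huv⟩ := Finset.one_lt_card.1 hcard
  simp only [Finset.mem_filter, Finset.mem_univ, true_and] at hu hv
  rcases Int.units_eq_one_or (sign g) with h1 | h1
  · exact ⟨⟨g, mem_alternatingGroup.2 h1⟩, fun z => rfl⟩
  · refine ⟨⟨swap u v * g, mem_alternatingGroup.2 ?_⟩, fun z => ?_⟩
    · rw [Perm.sign_mul, sign_swap huv, h1]; decide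
    · show l (swap u v (g z)) = l (g z)
      rw [swap_apply_def]
      split_ifs with e1 e2
      · rw [e1, hu, hv]
      · rw [e2, hu, hv]
      · rfl

open Equiv Equiv.Perm in
theorem assemble {n p a : ℕ} (hn : 5 ≤ n) (s : Perm (Fin n)) (l : Fin n → Fin 3)
    (h : Good p a s l) (hsg : sign s = 1)
    (hp : p.Prime) (hp3 : 3 ≤ p) (hpa : Nat.Coprime a p) (hpn : ¬ p ∣ n) (hna : n < 2 * (p + a))
    (h2 : 2 * p ≤ n + 1) (T : Finset (Perm (Fin n))) (hT : T.card ≤ 60 * Nat.log 2 n)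
    (hx : ∀ x : Perm (Fin n), x ≠ 1 → sign x = 1 → ∃ g ∈ T, ∃ u : Fin n,
      ∀ (y : Perm (Fin n)) (l' : Fin n → Fin 3), (∀ z, l' z = l (g z)) → Good p a y l' →
        ∀ z, ∃ t ∈ Subgroup.closure {x, y}, l' (t u) = l' z) :
    ∃ (s : alternatingGroup (Fin n)) (S : Finset (alternatingGroup (Fin n))),
      (↑S : Set (alternatingGroup (Fin n))) ⊆ {y | IsConj s y} ∧
      (S.card : ℝ) ≤ 77 * Real.logb 2 n ∧
      ∀ x : alternatingGroup (Fin n), x ≠ 1 →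
        ∃ y ∈ S, Subgroup.closure {x, y} = (⊤ : Subgroup (alternatingGroup (Fin n))) := by
  classical
  choose f hf using exists_even h (by omega)
  let s' : alternatingGroup (Fin n) := ⟨s, mem_alternatingGroup.2 hsg⟩
  refine ⟨s', T.image (fun g => (f g)⁻¹ * s' * f g), ?_, ?_, ?_⟩
  · intro y hy
    simp only [Finset.coe_image, Set.mem_image] at hy
    obtain ⟨g, _, rfl⟩ := hy
    show IsConj _ _
    rw [isConj_iff]
    exact ⟨(f g)⁻¹, by simp⟩
  · have h1 : ((T.image (fun g => (f g)⁻¹ * s' * f g)).card : ℝ) ≤ ((60 * Nat.log 2 n : ℕ) : ℝ) := by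
      exact_mod_cast Finset.card_image_le.trans hT
    have h3 := Real.natLog_le_logb n 2
    have h4 : (0 : ℝ) ≤ Nat.log 2 n := by positivity
    push_cast at h1 h3
    linarith
  · intro x hx1
    obtain ⟨g, hg, u, hu⟩ := hx x (fun h => hx1 (Subtype.ext h)) (mem_alternatingGroup.1 x.2)
    refine ⟨(f g)⁻¹ * s' * f g, Finset.mem_image_of_mem _ hg, ?_⟩
    apply alt_closure_top
    have hG := h.conj (f g : Perm (Fin n))
    have hy : (((f g)⁻¹ * s' * f g : alternatingGroup (Fin n)) : Perm (Fin n)) =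
      (f g : Perm (Fin n))⁻¹ * s * (f g : Perm (Fin n)) := rfl
    rw [hy]
    refine hG.alternating_le hp hpa hpn hna h2 (by omega) _ (Subgroup.subset_closure (by simp)) ?_
    exact hG.pretransitive _ (Subgroup.subset_closure (by simp)) u (hu _ _ (hf g) hG)

theorem fin3_cases (a b c d : Fin 3) (h1 : a ≠ b) (h2 : a ≠ c) (h3 : b ≠ c) :
    d = a ∨ d = b ∨ d = c := by
  revert a b c d; decide

theorem fin3_cases2 (a b d : Fin 3) (h1 : a ≠ b) (h2 : a ≠ 2) (h3 : b ≠ 2) (h4 : d ≠ 2) :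
    d = a ∨ d = b := by
  revert a b d; decide

open Equiv Equiv.Perm Finset in
theorem main_even (n p : ℕ) (hn : 5 ≤ n) (he : Even n) (hp : p.Prime) (hp3 : 3 ≤ p)
    (h6 : n < 6 * p) (h2 : 2 * p ≤ n + 1) (hpn : ¬ p ∣ n) :
    ∃ (s : alternatingGroup (Fin n)) (S : Finset (alternatingGroup (Fin n))),
      (↑S : Set (alternatingGroup (Fin n))) ⊆ {y | IsConj s y} ∧
      (S.card : ℝ) ≤ 77 * Real.logb 2 n ∧
      ∀ x : alternatingGroup (Fin n), x ≠ 1 →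
        ∃ y ∈ S, Subgroup.closure {x, y} = (⊤ : Subgroup (alternatingGroup (Fin n))) := by
  have hpo : Odd p := hp.odd_of_ne_two (by omega)
  obtain ⟨a, ha⟩ : ∃ a, p + a = n := ⟨n - p, by omega⟩
  have hao : Odd a := by
    rw [← ha] at he
    by_contra hc
    rw [Nat.not_odd_iff_even] at hc
    exact (Nat.not_even_iff_odd.2 (hpo.add_even hc)) he
  have hpa : Nat.Coprime a p := by
    rw [Nat.coprime_comm, hp.coprime_iff_not_dvd]
    intro hd
    exact hpn (ha ▸ Dvd.dvd.add dvd_rfl hd)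
  obtain ⟨s, l, hG, hsg, h1, h2'⟩ := exists_good n p a 0 (by omega) (Or.inl rfl) (by omega)
    (by omega)
  have hs1 : sign s = 1 := by
    rw [hsg, (hpo.tsub_odd odd_one).neg_one_pow, (hao.tsub_odd odd_one).neg_one_pow]
    simp
  obtain ⟨T, hT, hTT⟩ := family_two l p a ha hn h6 h2 hG.c0 h1 h2'
  have hl2 : ∀ z, l z ≠ 2 := by
    intro z hz
    rw [card_eq_zero] at h2'
    have : z ∈ ({x | l x = 2} : Finset (Fin n)) := by simp [hz]
    rw [h2'] at this
    simp at this
  refine assemble hn s l hG hs1 hp hp3 hpa hpn (by omega) h2 T hT ?_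
  intro x hx _
  obtain ⟨i, hi⟩ : ∃ i, x i ≠ i := by
    by_contra! h
    exact hx (Equiv.ext h)
  obtain ⟨g, hg, hgl⟩ := hTT i (x i) hi.symm
  refine ⟨g, hg, i, fun y l' hl' _ z => ?_⟩
  rcases fin3_cases2 (l' i) (l' (x i)) (l' z) (by rw [hl', hl']; exact hgl)
    (by rw [hl']; exact hl2 _) (by rw [hl']; exact hl2 _) (by rw [hl']; exact hl2 _) with h | h
  · exact ⟨1, Subgroup.one_mem _, h.symm⟩
  · exact ⟨x, Subgroup.subset_closure (by simp), h.symm⟩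

open Equiv Equiv.Perm Finset in
theorem main_odd (n p : ℕ) (hn : 5 ≤ n) (he : Odd n) (hp : p.Prime) (hp3 : 3 ≤ p)
    (h6 : n < 6 * p) (h2 : 2 * p ≤ n + 1) (hpn : ¬ p ∣ n) :
    ∃ (s : alternatingGroup (Fin n)) (S : Finset (alternatingGroup (Fin n))),
      (↑S : Set (alternatingGroup (Fin n))) ⊆ {y | IsConj s y} ∧
      (S.card : ℝ) ≤ 77 * Real.logb 2 n ∧
      ∀ x : alternatingGroup (Fin n), x ≠ 1 →
        ∃ y ∈ S, Subgroup.closure {x, y} = (⊤ : Subgroup (alternatingGroup (Fin n))) := by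
  have hpo : Odd p := hp.odd_of_ne_two (by omega)
  obtain ⟨a, ha⟩ : ∃ a, p + (a + a) = n := by
    obtain ⟨u, hu⟩ := he
    obtain ⟨v, hv⟩ := hpo
    exact ⟨u - v, by omega⟩
  have hpa : Nat.Coprime a p := by
    rw [Nat.coprime_comm, hp.coprime_iff_not_dvd]
    intro hd
    exact hpn (ha ▸ Dvd.dvd.add dvd_rfl (Dvd.dvd.add hd hd))
  obtain ⟨s, l, hG, hsg, h1, h2'⟩ := exists_good n p a a (by omega) (Or.inr rfl) (by omega)
    (by omega)
  have hs1 : sign s = 1 := by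
    rw [hsg, (hpo.tsub_odd odd_one).neg_one_pow, ← pow_add, Even.neg_one_pow ⟨_, rfl⟩]
    simp
  obtain ⟨T, hT, hTT⟩ := family_four l p a ha hn h6 h2 hG.c0 h1 h2'
  refine assemble hn s l hG hs1 hp hp3 hpa hpn (by omega) h2 T hT ?_
  intro x hx hsx
  obtain ⟨i, j, k, m, hij, hik, him, hjk, hjm, hkm, hxi, hor⟩ := exists_pattern hn x hx hsx
  obtain ⟨g, hg, c1, c2, c3, c4⟩ := hTT i j k m hij hik him hjk hjm hkm
  refine ⟨g, hg, i, fun y l' hl' hy z => ?_⟩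
  simp only [← hl'] at c1 c2 c3 c4
  have hxm : x ∈ Subgroup.closure {x, y} := Subgroup.subset_closure (by simp)
  have hym : y ∈ Subgroup.closure {x, y} := Subgroup.subset_closure (by simp)
  rcases fin3_cases (l' i) (l' j) (l' k) (l' z) c1 c2 c3 with h | h | h
  · exact ⟨1, Subgroup.one_mem _, h.symm⟩
  · exact ⟨x, hxm, by rw [hxi, h]⟩
  · rcases hor with hor | hor
    · exact ⟨x * x, Subgroup.mul_mem _ hxm hxm, by rw [Perm.mul_apply, hxi, hor, h]⟩
    · have hk : x⁻¹ m = k := by rw [← hor]; simp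
      rcases fin3_cases (l' i) (l' j) (l' k) (l' m) c1 c2 c3 with h' | h' | h'
      · obtain ⟨e, he⟩ := hy.cyc i m h'.symm
        exact ⟨x⁻¹ * y ^ e, Subgroup.mul_mem _ (Subgroup.inv_mem _ hxm)
          (Subgroup.pow_mem _ hym e), by rw [Perm.mul_apply, he, hk, h]⟩
      · obtain ⟨e, he⟩ := hy.cyc j m h'.symm
        exact ⟨x⁻¹ * y ^ e * x, Subgroup.mul_mem _ (Subgroup.mul_mem _ (Subgroup.inv_mem _ hxm)
          (Subgroup.pow_mem _ hym e)) hxm, by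
            rw [Perm.mul_apply, Perm.mul_apply, hxi, he, hk, h]⟩
      · exact absurd h' c4

end AUD
namespace AUD

open Equiv Equiv.Perm

/-- the 5-cycle used for the alternating group of degree 6 -/
def s6 : Perm (Fin 6) := ⟨![1, 2, 3, 4, 0, 5], ![4, 0, 1, 2, 3, 5], by decide, by decide⟩

/-- its labelling -/
def l6 : Fin 6 → Fin 3 := ![0, 0, 0, 0, 0, 1]

theorem good6 : Good 5 1 s6 l6 where
  inv := by decide
  cyc := by
    have : ∀ x y, l6 x = l6 y → ∃ k : Fin 5, (s6 ^ (k : ℕ)) x = y := by decide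
    intro x y h
    obtain ⟨k, hk⟩ := this x y h
    exact ⟨k, hk⟩
  c0 := by decide
  c1 := by decide
  per0 := by decide
  per1 := by decide

theorem gen6 (r w : Perm (Fin 6)) (hr : l6 (r 5) = 0) (hw : w.support.card = 3)
    (H : Subgroup (Perm (Fin 6))) (hrH : r ∈ H) (hsH : s6 ∈ H) (hwH : w ∈ H) :
    alternatingGroup (Fin 6) ≤ H := by
  refine alternatingGroup_le_of_isPreprimitive_of_isThreeCycle_mem ?_
    (card_support_eq_three_iff.1 hw) hwH
  refine good6.preprimitive (by norm_num) (by norm_num) (by norm_num) (by norm_num) H hsH ?_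
  refine good6.pretransitive H hsH 5 fun z => ?_
  have : ∀ z, l6 z = l6 5 ∨ l6 z = 0 := by decide
  rcases this z with h | h
  · exact ⟨1, H.one_mem, h.symm⟩
  · exact ⟨r, hrH, by rw [hr, h]⟩

/-- `r` together with `s6` generates at least the alternating group -/
def Q6 (r : Perm (Fin 6)) : Prop :=
  ∀ H : Subgroup (Perm (Fin 6)), r ∈ H → s6 ∈ H → alternatingGroup (Fin 6) ≤ H

theorem type_of (r : Perm (Fin 6)) (q m : ℕ) (hq : q.Prime) (h1 : r ^ q = 1) (h2 : r ≠ 1)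
    (h3 : r.support.card = m * q) : r.cycleType = Multiset.replicate m q := by
  have : Fact q.Prime := ⟨hq⟩
  have ho : orderOf r = q := orderOf_eq_prime h1 h2
  obtain ⟨k, hk⟩ := cycleType_prime_order (σ := r) (ho ▸ hq)
  rw [ho] at hk
  have := sum_cycleType r
  rw [hk, h3, Multiset.sum_replicate, smul_eq_mul] at this
  rw [hk, Nat.eq_of_mul_eq_mul_right hq.pos this]

theorem step6 (x r c : Perm (Fin 6)) (k : ℕ) (hc : sign c = -1) (hxr : (x ^ k).cycleType = r.cycleType)
    (h1 : Q6 r) (h2 : Q6 (c * r * c⁻¹)) :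
    ∃ t : alternatingGroup (Fin 6), alternatingGroup (Fin 6) ≤
      Subgroup.closure {x, (t : Perm (Fin 6)) * s6 * (t : Perm (Fin 6))⁻¹} := by
  obtain ⟨τ, hτ⟩ := isConj_iff.1 (isConj_iff_cycleType_eq.2 hxr.symm)
  have main : ∃ (t : alternatingGroup (Fin 6)) (r' : Perm (Fin 6)), Q6 r' ∧
      (t : Perm (Fin 6)) * r' * (t : Perm (Fin 6))⁻¹ = x ^ k := by
    rcases Int.units_eq_one_or (sign τ) with h | h
    · exact ⟨⟨τ, mem_alternatingGroup.2 h⟩, r, h1, hτ⟩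
    · refine ⟨⟨τ * c⁻¹, mem_alternatingGroup.2 ?_⟩, _, h2, ?_⟩
      · rw [Perm.sign_mul, sign_inv, h, hc]; decide
      · rw [← hτ]
        show τ * c⁻¹ * (c * r * c⁻¹) * (τ * c⁻¹)⁻¹ = _
        group
  obtain ⟨t, r', hQ, ht⟩ := main
  refine ⟨t, fun g hg => ?_⟩
  set H := Subgroup.closure {x, (t : Perm (Fin 6)) * s6 * (t : Perm (Fin 6))⁻¹} with hH
  have hle := hQ (H.comap (MulAut.conj (t : Perm (Fin 6))).toMonoidHom) (by
      show (t : Perm (Fin 6)) * r' * (t : Perm (Fin 6))⁻¹ ∈ H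
      rw [ht]
      exact H.pow_mem (Subgroup.subset_closure (by simp)) k) (by
      show (t : Perm (Fin 6)) * s6 * (t : Perm (Fin 6))⁻¹ ∈ H
      exact Subgroup.subset_closure (by simp))
  have hg' : (t : Perm (Fin 6))⁻¹ * g * t ∈ alternatingGroup (Fin 6) :=
    Subgroup.mul_mem _ (Subgroup.mul_mem _ (Subgroup.inv_mem _ t.2) hg) t.2
  have h3 : (t : Perm (Fin 6)) * ((t : Perm (Fin 6))⁻¹ * g * t) * (t : Perm (Fin 6))⁻¹ ∈ H :=
    hle hg'
  have e : (t : Perm (Fin 6)) * ((t : Perm (Fin 6))⁻¹ * g * t) * (t : Perm (Fin 6))⁻¹ = g := by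
    group
  rwa [e] at h3

/-- representatives -/
def ra : Perm (Fin 6) := ⟨![0, 1, 2, 4, 5, 3], ![0, 1, 2, 5, 3, 4], by decide, by decide⟩
/-- representatives -/
def ca : Perm (Fin 6) := ⟨![0, 2, 1, 3, 4, 5], ![0, 2, 1, 3, 4, 5], by decide, by decide⟩
/-- representatives -/
def rb : Perm (Fin 6) := ⟨![0, 1, 3, 2, 5, 4], ![0, 1, 3, 2, 5, 4], by decide, by decide⟩
/-- representatives -/
def cb : Perm (Fin 6) := ⟨![0, 1, 2, 3, 5, 4], ![0, 1, 2, 3, 5, 4], by decide, by decide⟩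
/-- representatives -/
def rc : Perm (Fin 6) := ⟨![2, 0, 1, 5, 3, 4], ![1, 2, 0, 4, 5, 3], by decide, by decide⟩
/-- representatives -/
def cc : Perm (Fin 6) := ⟨![3, 4, 5, 0, 1, 2], ![3, 4, 5, 0, 1, 2], by decide, by decide⟩
/-- representatives -/
def rd : Perm (Fin 6) := ⟨![0, 3, 4, 5, 1, 2], ![0, 4, 5, 1, 2, 3], by decide, by decide⟩
/-- representatives -/
def cd : Perm (Fin 6) := ⟨![0, 1, 3, 5, 2, 4], ![0, 1, 4, 2, 5, 3], by decide, by decide⟩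
/-- representatives -/
def re : Perm (Fin 6) := ⟨![0, 5, 1, 2, 3, 4], ![0, 2, 3, 4, 5, 1], by decide, by decide⟩

theorem qa : Q6 ra := fun H hr hs => gen6 ra ra (by decide) (by decide) H hr hs hr

theorem qb : Q6 rb := fun H hr hs =>
  gen6 rb (rb * s6 * rb * s6 ^ 3 * rb * s6 ^ 2) (by decide) (by decide) H hr hs
    (H.mul_mem (H.mul_mem (H.mul_mem (H.mul_mem (H.mul_mem hr hs) hr) (H.pow_mem hs 3)) hr)
      (H.pow_mem hs 2))

theorem qc : Q6 rc := fun H hr hs =>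
  gen6 rc (rc * s6) (by decide) (by decide) H hr hs (H.mul_mem hr hs)

theorem qd : Q6 rd := fun H hr hs =>
  gen6 rd (rd * rd * s6) (by decide) (by decide) H hr hs (H.mul_mem (H.mul_mem hr hr) hs)

theorem qe : Q6 re := fun H hr hs =>
  gen6 re (re * s6) (by decide) (by decide) H hr hs (H.mul_mem hr hs)

theorem exists6 (x : Perm (Fin 6)) (hx : x ≠ 1) (hs : sign x = 1) :
    ∃ t : alternatingGroup (Fin 6), alternatingGroup (Fin 6) ≤
      Subgroup.closure {x, (t : Perm (Fin 6)) * s6 * (t : Perm (Fin 6))⁻¹} := by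
  have ho1 : orderOf x ≠ 1 := fun h => hx (orderOf_eq_one_iff.1 h)
  obtain ⟨q, hq, hqd⟩ := Nat.exists_prime_and_dvd ho1
  have hoy := orderOf_pow_orderOf_div (x := x) (orderOf_pos x).ne' hqd
  set k := orderOf x / q
  have hsy : sign (x ^ k) = 1 := by rw [map_pow, hs, one_pow]
  obtain ⟨m, hm⟩ := cycleType_prime_order (σ := x ^ k) (hoy.symm ▸ hq)
  rw [hoy] at hm
  have hle := sum_cycleType_le (x ^ k)
  rw [sign_of_cycleType, hm] at hsy
  rw [hm] at hle
  simp only [Multiset.sum_replicate, smul_eq_mul, Multiset.card_replicate, Fintype.card_fin]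
    at hle hsy
  have hq2 := hq.two_le
  have hm6 : m ≤ 2 := by nlinarith
  have hq6 : q ≤ 6 := by nlinarith
  have ha : Q6 (ca * ra * ca⁻¹) := by
    have : ca * ra * ca⁻¹ = ra := by decide
    rw [this]; exact qa
  have hb : Q6 (cb * rb * cb⁻¹) := by
    have : cb * rb * cb⁻¹ = rb := by decide
    rw [this]; exact qb
  have hc : Q6 (cc * rc * cc⁻¹) := by
    have : cc * rc * cc⁻¹ = rc := by decide
    rw [this]; exact qc
  have hd : Q6 (cd * rd * cd⁻¹) := by
    have : cd * rd * cd⁻¹ = re := by decide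
    rw [this]; exact qe
  have cases : (q = 3 ∧ m = 0) ∨ (q = 2 ∧ m = 1) ∨ (q = 3 ∧ m = 1) ∨ (q = 5 ∧ m = 0) := by
    interval_cases q <;> interval_cases m <;> first | omega | (exfalso; revert hsy; decide) |
      (exfalso; revert hq; norm_num)
  rcases cases with ⟨rfl, rfl⟩ | ⟨rfl, rfl⟩ | ⟨rfl, rfl⟩ | ⟨rfl, rfl⟩
  · exact step6 x ra ca k (by decide)
      (hm.trans (type_of ra 3 1 hq (by decide) (by decide) (by decide)).symm) qa ha
  · exact step6 x rb cb k (by decide)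
      (hm.trans (type_of rb 2 2 hq (by decide) (by decide) (by decide)).symm) qb hb
  · exact step6 x rc cc k (by decide)
      (hm.trans (type_of rc 3 2 hq (by decide) (by decide) (by decide)).symm) qc hc
  · exact step6 x rd cd k (by decide)
      (hm.trans (type_of rd 5 1 hq (by decide) (by decide) (by decide)).symm) qd hd

theorem main_six :
    ∃ (s : alternatingGroup (Fin 6)) (S : Finset (alternatingGroup (Fin 6))),
      (↑S : Set (alternatingGroup (Fin 6))) ⊆ {y | IsConj s y} ∧
      (S.card : ℝ) ≤ 77 * Real.logb 2 (6 : ℕ) ∧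
      ∀ x : alternatingGroup (Fin 6), x ≠ 1 →
        ∃ y ∈ S, Subgroup.closure {x, y} = (⊤ : Subgroup (alternatingGroup (Fin 6))) := by
  classical
  have ht : s6.cycleType = {5} :=
    type_of s6 5 1 (by norm_num) (by decide) (by decide) (by decide)
  let s' : alternatingGroup (Fin 6) := ⟨s6, mem_alternatingGroup.2 (by decide)⟩
  refine ⟨s', Finset.univ.filter (fun y => IsConj s' y), ?_, ?_, ?_⟩
  · intro y hy
    exact (Finset.mem_filter.1 (Finset.mem_coe.1 hy)).2
  · have h1 : (Finset.univ.filter (fun y => IsConj s' y)).card ≤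
        (Finset.univ.filter (fun g : Perm (Fin 6) => g.cycleType = {5})).card := by
      refine Finset.card_le_card_of_injOn (fun y => (y : Perm (Fin 6))) ?_
        (fun a _ b _ h => Subtype.ext h)
      intro y hy
      have hy' : IsConj s' y := (Finset.mem_filter.1 (Finset.mem_coe.1 hy)).2
      obtain ⟨c, hc⟩ := isConj_iff.1 hy'
      refine Finset.mem_coe.2 (Finset.mem_filter.2 ⟨Finset.mem_univ _, ?_⟩)
      rw [← ht]
      refine (isConj_iff_cycleType_eq.1 (isConj_iff.2 ⟨(c : Perm (Fin 6)), ?_⟩)).symm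
      rw [← hc]
      rfl
    rw [card_of_cycleType_singleton (by norm_num) (by simp)] at h1
    have h2 : (4 : ℕ).factorial * (6 : ℕ).choose 5 = 144 := by decide
    simp only [Fintype.card_fin, Nat.add_one_sub_one] at h1
    have h3 : ((Finset.univ.filter (fun y => IsConj s' y)).card : ℝ) ≤ 144 := by
      exact_mod_cast h1.trans h2.le
    have h4 : (2 : ℝ) ≤ Real.logb 2 (6 : ℕ) := by
      rw [Real.le_logb_iff_rpow_le (by norm_num) (by norm_num)]
      norm_num
    linarith
  · intro x hx
    obtain ⟨t, h⟩ := exists6 x (fun h => hx (Subtype.ext h)) (mem_alternatingGroup.1 x.2)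
    refine ⟨t * s' * t⁻¹, Finset.mem_filter.2 ⟨Finset.mem_univ _, isConj_iff.2 ⟨t, rfl⟩⟩, ?_⟩
    exact alt_closure_top _ _ h

end AUD

/-- Burness–Harper: for `n ≥ 5` the uniform domination number of the alternating
group `Aₙ` is at most `77 · log₂ n`: there is a set `S` of conjugate elements with
`|S| ≤ 77 · log₂ n` such that every nontrivial element of `Aₙ` generates `Aₙ`
together with some member of `S`. -/
theorem alternating_uniform_domination_bound (n : ℕ) (hn : 5 ≤ n) :
    ∃ (s : alternatingGroup (Fin n)) (S : Finset (alternatingGroup (Fin n))),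
      (↑S : Set (alternatingGroup (Fin n))) ⊆ {y | IsConj s y} ∧
      (S.card : ℝ) ≤ 77 * Real.logb 2 n ∧
      ∀ x : alternatingGroup (Fin n), x ≠ 1 →
        ∃ y ∈ S, Subgroup.closure {x, y} = (⊤ : Subgroup (alternatingGroup (Fin n))) := by
  by_cases h6 : n = 6
  · subst h6
    exact AUD.main_six
  · obtain ⟨p, hp, hp3, h1, h2, h3⟩ := AUD.exists_good_prime n hn h6
    rcases Nat.even_or_odd n with he | ho
    · exact AUD.main_even n p hn he hp hp3 h1 h2 h3
    · exact AUD.main_odd n p hn ho hp hp3 h1 h2 h3
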